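/- Let A and H be groups, φ : A →* H an injective homomorphism, n : ℕ, and let G = Monoid.PushoutI (fun _ : Fin n => φ) be the star of isomorphic groups with n rays, with ray-permuting homomorphisms Φ σ : G →* G for σ : Equiv.Perm (Fin n). Suppose g ∈ G admits a cyclically reduced word datum of length ≥ 1 in which every index i : Fin n is represented. Let σ = Equiv.swap a b, τ = Equiv.swap c d, δ = Equiv.swap e f be three transpositions of Fin n with the six points a, b, c, d, e, f pairwise distinct. Then the three elements Φ σ g, Φ τ g, Φ δ g are not all pairwise conjugate in G; that is, it is not the case that both IsConj (Φ σ g) (Φ τ g) and IsConj (Φ σ g) (Φ δ g) hold. -/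

import Mathlib

open Monoid

/-- A reduced word datum of length `l.length` for an element `g` of the star of isomorphic
groups `Monoid.PushoutI (fun _ : Fin n => φ)`. -/
def IsReducedDatum {A H : Type*} [Group A] [Group H] {n : ℕ} (φ : A →* H)
    (g : Monoid.PushoutI (fun _ : Fin n => φ)) (a : A) (l : List (Fin n × H)) : Prop :=
  (∀ p ∈ l, p.2 ∉ Set.range φ) ∧
  l.Chain' (fun p q => p.1 ≠ q.1) ∧
  g = Monoid.PushoutI.base (fun _ : Fin n => φ) a *
      (l.map fun p => Monoid.PushoutI.of (φ := fun _ : Fin n => φ) p.1 p.2).prod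

/-- A cyclically reduced word datum: a reduced word datum whose first and last letters lie
in different factors whenever the length is greater than 1. -/
def IsCyclicallyReducedDatum {A H : Type*} [Group A] [Group H] {n : ℕ} (φ : A →* H)
    (g : Monoid.PushoutI (fun _ : Fin n => φ)) (a : A) (l : List (Fin n × H)) : Prop :=
  IsReducedDatum φ g a l ∧
  (1 < l.length → ∀ p ∈ l.head?, ∀ q ∈ l.getLast?, p.1 ≠ q.1)

namespace Monoid.PushoutI

section Syllables

variable {ι : Type*} {G : ι → Type*} {H : Type*} [∀ i, Group (G i)] [Group H]
  {φ : ∀ i, H →* G i}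

variable (φ) in
/-- `HasSyllables φ x L` says that `x` is represented by a reduced word whose letters lie in the
factors listed, in order, by `L`. -/
inductive HasSyllables : PushoutI φ → List ι → Prop
  | base (a : H) : HasSyllables (base φ a) []
  | cons {x : PushoutI φ} {L : List ι} (i : ι) (g : G i) (hg : g ∉ (φ i).range)
      (hi : i ∉ L.head?) (hx : HasSyllables x L) : HasSyllables (of i g * x) (i :: L)

namespace HasSyllables

theorem base_mul {x : PushoutI φ} {L : List ι} (hx : HasSyllables φ x L) (a : H) :
    HasSyllables φ (PushoutI.base φ a * x) L := by
  cases hx with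
  | base b => simpa using HasSyllables.base (φ := φ) (a * b)
  | cons i g hg hi hx =>
    rw [← of_apply_eq_base φ i, ← mul_assoc, ← map_mul]
    exact cons i _ (by rwa [Subgroup.mul_mem_cancel_left _ (MonoidHom.mem_range.2 ⟨a, rfl⟩)]) hi hx

theorem append {x y : PushoutI φ} {L M : List ι} (hx : HasSyllables φ x L)
    (hy : HasSyllables φ y M) (h : ∀ i ∈ L.getLast?, i ∉ M.head?) :
    HasSyllables φ (x * y) (L ++ M) := by
  induction hx with
  | base a => exact hy.base_mul a
  | @cons x L i g hg hi hx ih =>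
    rw [mul_assoc]
    cases L with
    | nil => exact cons i g hg (h i (by simp)) (ih (by simp))
    | cons j L => exact cons i g hg (by simpa using hi) (ih (by simpa using h))

theorem of_notMem_range {i : ι} {g : G i} (hg : g ∉ (φ i).range) :
    HasSyllables φ (of i g) [i] := by
  simpa using cons i g hg (by simp) (base 1)

theorem inv {x : PushoutI φ} {L : List ι} (hx : HasSyllables φ x L) :
    HasSyllables φ x⁻¹ L.reverse := by
  induction hx with
  | base a => simpa using HasSyllables.base (φ := φ) a⁻¹
  | cons i g hg hi hx ih =>
    rw [mul_inv_rev, ← map_inv, List.reverse_cons]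
    refine ih.append (of_notMem_range (by simpa using hg)) ?_
    rintro j hj hj'
    simp only [List.getLast?_reverse, List.head?_cons, Option.mem_def, Option.some.injEq] at hj hj'
    exact hi (hj' ▸ hj)

theorem pow {x : PushoutI φ} {L : List ι} (hx : HasSyllables φ x L)
    (h : ∀ i ∈ L.getLast?, i ∉ L.head?) (N : ℕ) :
    HasSyllables φ (x ^ N) (List.replicate N L).flatten := by
  induction N with
  | zero => simpa using HasSyllables.base (φ := φ) 1
  | succ N ih =>
    rw [pow_succ', List.replicate_succ, List.flatten_cons]
    refine hx.append ih fun i hi hi' => ?_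
    cases N with
    | zero => simp at hi'
    | succ N =>
      cases L with
      | nil => simp at hi
      | cons j L => exact h i hi (by simpa [List.replicate_succ] using hi')

theorem unique (hφ : ∀ i, Function.Injective (φ i)) {x : PushoutI φ} {L M : List ι}
    (hL : HasSyllables φ x L) (hM : HasSyllables φ x M) : L = M := by
  obtain ⟨d⟩ := NormalWord.transversal_nonempty φ hφ
  have key {y : PushoutI φ} {K : List ι} (hy : HasSyllables φ y K) :
      ∃ w : NormalWord d, w.prod = y ∧ w.toList.map Sigma.fst = K := by
    induction hy with
    | base a => exact ⟨a • NormalWord.empty, by simp, by simp [NormalWord.base_smul_def']⟩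
    | cons i g hg hi hx ih =>
      obtain ⟨w, rfl, rfl⟩ := ih
      exact ⟨NormalWord.cons g w (by simpa [CoprodI.Word.fstIdx] using hi) hg, by simp, by simp⟩
  obtain ⟨v, hv, rfl⟩ := key hL
  obtain ⟨w, hw, rfl⟩ := key hM
  rw [NormalWord.prod_injective (hv.trans hw.symm)]

theorem of_mul {x : PushoutI φ} {L : List ι} (hx : HasSyllables φ x L) (i : ι) (g : G i) :
    ∃ k ≤ 1, ∃ P : List ι, P.length ≤ 1 ∧ HasSyllables φ (of i g * x) (P ++ L.drop k) := by
  by_cases hg : g ∈ (φ i).range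
  · obtain ⟨a, rfl⟩ := hg
    exact ⟨0, by simp, [], by simp, by simpa [of_apply_eq_base] using hx.base_mul a⟩
  by_cases hi : i ∈ L.head?
  · cases hx with
    | base a => simp at hi
    | cons j y hy hj hx =>
      obtain rfl : j = i := by simpa using hi
      rw [← mul_assoc, ← map_mul]
      by_cases hgy : g * y ∈ (φ j).range
      · obtain ⟨a, ha⟩ := hgy
        refine ⟨1, le_rfl, [], by simp, ?_⟩
        simpa [← ha, of_apply_eq_base] using hx.base_mul a
      · exact ⟨1, le_rfl, [j], by simp, cons j _ hgy hj hx⟩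
  · exact ⟨0, by simp, [i], by simp, cons i g hg hi hx⟩

end HasSyllables

/-- Left multiplication by a fixed element only changes a prefix of bounded length of the
syllable sequence. -/
theorem exists_hasSyllables_mul_left (c : PushoutI φ) :
    ∃ K : ℕ, ∀ (x : PushoutI φ) (L : List ι), HasSyllables φ x L →
      ∃ k ≤ K, ∃ P : List ι, P.length ≤ K ∧ HasSyllables φ (c * x) (P ++ L.drop k) := by
  induction c using PushoutI.induction_on with
  | of i g => exact ⟨1, fun x L hx => hx.of_mul i g⟩
  | base a => exact ⟨0, fun x L hx => ⟨0, le_rfl, [], le_rfl, hx.base_mul a⟩⟩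
  | mul c c' hc hc' =>
    obtain ⟨K, hK⟩ := hc
    obtain ⟨K', hK'⟩ := hc'
    refine ⟨K + K', fun x L hx => ?_⟩
    obtain ⟨k', hk', P', hP', h'⟩ := hK' x L hx
    obtain ⟨k, hk, P, hP, h⟩ := hK _ _ h'
    refine ⟨k' + (k - P'.length), by lia, P ++ P'.drop k, ?_, ?_⟩
    · simp only [List.length_append, List.length_drop]
      lia
    · rw [List.drop_append, List.drop_drop] at h
      simpa [mul_assoc] using h

theorem exists_hasSyllables_mul_right (c : PushoutI φ) :
    ∃ K : ℕ, ∀ (x : PushoutI φ) (L : List ι), HasSyllables φ x L →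
      ∃ k ≤ K, ∃ Q : List ι, Q.length ≤ K ∧
        HasSyllables φ (x * c) (L.take (L.length - k) ++ Q) := by
  obtain ⟨K, hK⟩ := exists_hasSyllables_mul_left c⁻¹
  refine ⟨K, fun x L hx => ?_⟩
  obtain ⟨k, hk, P, hP, h⟩ := hK _ _ hx.inv
  refine ⟨k, hk, P.reverse, by simpa using hP, ?_⟩
  simpa [List.reverse_drop] using h.inv

end Syllables

end Monoid.PushoutI

namespace List

theorem getElem?_flatten_replicate {α : Type*} (s : List α) {N p : ℕ} (hp : p < N * s.length) :
    (replicate N s).flatten[p]? = s[p % s.length]? := by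
  induction N generalizing p with
  | zero => simp at hp
  | succ N ih =>
    rw [replicate_succ, flatten_cons]
    by_cases h : p < s.length
    · rw [getElem?_append_left h, Nat.mod_eq_of_lt h]
    · rw [getElem?_append_right (by lia), ih (by rw [Nat.succ_mul] at hp; lia),
        ← Nat.mod_eq_sub_mod (by lia)]

/-- Two lists of the same length are rotations of each other as soon as long enough periodic
words spelled by them agree away from their ends. -/
theorem isRotated_of_append_drop_eq_take_append {α : Type*} {s t P Q : List α} {K k k' : ℕ}
    (hst : s.length = t.length) (hP : P.length ≤ K) (hk : k ≤ K) (hk' : k' ≤ K)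
    (h : P ++ (replicate (2 * K + 1) s).flatten.drop k =
      (replicate (2 * K + 1) t).flatten.take ((2 * K + 1) * t.length - k') ++ Q) :
    s ~r t := by
  refine ⟨k + s.length * P.length - P.length, ext_getElem (by simpa using hst) fun i hi hi' => ?_⟩
  rw [length_rotate] at hi
  have hm : 1 ≤ s.length := by lia
  have h₁ : P.length ≤ s.length * P.length := Nat.le_mul_of_pos_left _ hm
  have h₂ : s.length * P.length ≤ s.length * K := Nat.mul_le_mul_left _ hP
  have h₃ : K ≤ s.length * K := Nat.le_mul_of_pos_left _ hm
  have h₄ : (2 * K + 1) * s.length = 2 * (s.length * K) + s.length := by ring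
  have h₅ := congrArg (·[i + s.length * P.length]?) h
  rw [getElem?_append_right (by lia), getElem?_drop,
    getElem?_flatten_replicate _ (by lia), getElem?_append_left, getElem?_take_of_lt,
    getElem?_flatten_replicate, ← hst, Nat.add_mul_mod_self_left, Nat.mod_eq_of_lt hi] at h₅
  · rw [getElem?_eq_getElem (Nat.mod_lt _ hm), getElem?_eq_getElem hi', Option.some_inj] at h₅
    rw [getElem_rotate, ← h₅]
    congr 2
    lia
  · lia
  · lia
  · rw [length_take, length_flatten, map_replicate, sum_replicate_nat]
    lia

end List

namespace Monoid.PushoutI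

/-- The syllable sequences of conjugate cyclically reduced elements of an amalgamated product are
rotations of each other. -/
theorem HasSyllables.isRotated_of_isConj {ι : Type*} {G : ι → Type*} {H : Type*}
    [∀ i, Group (G i)] [Group H] {φ : ∀ i, H →* G i} (hφ : ∀ i, Function.Injective (φ i))
    {x y : PushoutI φ} {L M : List ι} (hx : HasSyllables φ x L) (hy : HasSyllables φ y M)
    (hL : ∀ i ∈ L.getLast?, i ∉ L.head?) (hM : ∀ i ∈ M.getLast?, i ∉ M.head?)
    (hxy : IsConj x y) : L ~r M := by
  obtain ⟨c, hc⟩ := hxy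
  obtain ⟨K, hK⟩ := exists_hasSyllables_mul_left (c : PushoutI φ)
  obtain ⟨K', hK'⟩ := exists_hasSyllables_mul_right (c : PushoutI φ)
  set N := 2 * (K + K') + 1 with hN
  obtain ⟨k, hk, P, hP, h⟩ := hK _ _ (hx.pow hL N)
  obtain ⟨k', hk', Q, hQ, h'⟩ := hK' _ _ (hy.pow hM N)
  rw [(hc.pow_right N).eq] at h
  have heq := h.unique hφ h'
  rw [List.length_flatten, List.map_replicate, List.sum_replicate_nat] at heq
  have hlen : L.length = M.length := by
    have hl := congrArg List.length heq
    simp only [List.length_append, List.length_drop, List.length_take,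
      List.length_flatten, List.map_replicate, List.sum_replicate_nat] at hl
    rcases lt_trichotomy L.length M.length with hlt | heq | hlt
    · have := Nat.mul_le_mul_left N (Nat.succ_le_of_lt hlt)
      rw [Nat.mul_succ] at this
      lia
    · exact heq
    · have := Nat.mul_le_mul_left N (Nat.succ_le_of_lt hlt)
      rw [Nat.mul_succ] at this
      lia
  exact List.isRotated_of_append_drop_eq_take_append (K := K + K') hlen (by lia) (by lia)
    (by lia) heq

theorem HasSyllables.map_of_permutes {ι A H : Type*} [Group A] [Group H] [Nonempty ι] {φ : A →* H}
    {F : PushoutI (fun _ : ι => φ) →* PushoutI (fun _ : ι => φ)} {σ : Equiv.Perm ι}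
    (hF : ∀ i, F.comp (of (φ := fun _ : ι => φ) i) = of (φ := fun _ : ι => φ) (σ i))
    {x : PushoutI (fun _ : ι => φ)} {L : List ι} (hx : HasSyllables (fun _ : ι => φ) x L) :
    HasSyllables (fun _ : ι => φ) (F x) (L.map σ) := by
  have hF' (i : ι) (h : H) : F (of (φ := fun _ : ι => φ) i h) = of (φ := fun _ : ι => φ) (σ i) h :=
    DFunLike.congr_fun (hF i) h
  induction hx with
  | base a =>
    obtain ⟨i⟩ := ‹Nonempty ι›
    have ha := of_apply_eq_base (fun _ : ι => φ) (σ i) a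
    rw [← hF', of_apply_eq_base (fun _ : ι => φ) i a] at ha
    rw [ha]
    exact base (φ := fun _ : ι => φ) a
  | cons i g hg hi hx ih =>
    rw [map_mul, hF']
    exact cons (φ := fun _ : ι => φ) (σ i) g hg (by simpa using hi) ih

end Monoid.PushoutI

theorem IsReducedDatum.hasSyllables {A H : Type*} [Group A] [Group H] {n : ℕ} {φ : A →* H}
    {g : Monoid.PushoutI (fun _ : Fin n => φ)} {a : A} {l : List (Fin n × H)}
    (h : IsReducedDatum φ g a l) :
    Monoid.PushoutI.HasSyllables (fun _ : Fin n => φ) g (l.map Prod.fst) := by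
  obtain ⟨hl, hchain, rfl⟩ := h
  refine Monoid.PushoutI.HasSyllables.base_mul ?_ a
  induction l with
  | nil => simpa using Monoid.PushoutI.HasSyllables.base (φ := fun _ : Fin n => φ) 1
  | cons p l ih =>
    rw [List.map_cons, List.prod_cons, List.map_cons]
    refine .cons (φ := fun _ : Fin n => φ) p.1 p.2 (hl p List.mem_cons_self) ?_
      (ih (fun q hq => hl q (List.mem_cons_of_mem _ hq)) hchain.tail)
    cases l with
    | nil => simp
    | cons q l => simpa using (List.isChain_cons_cons.1 hchain).1.symm

/-- If shifts of a surjection from a cyclic group induce two nontrivial involutions of its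
codomain, then these involutions coincide. -/
theorem Equiv.Perm.eq_of_cyclic_shift {Z X : Type*} [AddCommGroup Z] [IsAddCyclic Z] [Finite X]
    {t : Z → X} (ht : Function.Surjective t) {u v : Equiv.Perm X} {p q : Z}
    (hu : ∀ x, t (x + p) = u (t x)) (hv : ∀ x, t (x + q) = v (t x))
    (hu2 : u ^ 2 = 1) (hv2 : v ^ 2 = 1) (hu1 : u ≠ 1) (hv1 : v ≠ 1) : u = v := by
  classical
  let T : Subgroup (Multiplicative Z × Equiv.Perm X) :=
    { carrier := {r | ∀ x, t (x + r.1.toAdd) = r.2 (t x)}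
      one_mem' := by simp
      mul_mem' := by
        intro r s hr hs x
        rw [Set.mem_ofPred_eq] at hr hs
        simp [add_comm r.1.toAdd, ← add_assoc, hr, hs]
      inv_mem' := by
        intro r hr x
        exact Equiv.Perm.eq_inv_iff_eq.2 (by simp [← hr (x + -r.1.toAdd)]) }
  have hinj : Function.Injective ((MonoidHom.fst _ _).comp T.subtype) := by
    rintro ⟨⟨r, π⟩, hr⟩ ⟨⟨s, ρ⟩, hs⟩ h
    obtain rfl : r = s := h
    simp only [Subtype.mk.injEq, Prod.mk.injEq, true_and]
    ext y
    obtain ⟨x, rfl⟩ := ht y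
    exact (hr x).symm.trans (hs x)
  have : IsCyclic T := isCyclic_of_injective _ hinj
  let f := (MonoidHom.snd _ _).comp T.subtype
  have : IsCyclic f.range := isCyclic_of_surjective _ f.rangeRestrict_surjective
  have := Fintype.ofFinite f.range
  have hcard := IsCyclic.card_pow_eq_one_le (α := f.range) (n := 2) two_pos
  let u' : f.range := ⟨u, ⟨⟨(.ofAdd p, u), hu⟩, rfl⟩⟩
  let v' : f.range := ⟨v, ⟨⟨(.ofAdd q, v), hv⟩, rfl⟩⟩
  by_contra huv
  have hsub : ({1, u', v'} : Finset f.range) ⊆ Finset.univ.filter (· ^ 2 = 1) := by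
    intro x hx
    simp only [Finset.mem_insert, Finset.mem_singleton] at hx
    rcases hx with rfl | rfl | rfl <;> simp [Subtype.ext_iff, u', v', hu2, hv2]
  have := (Finset.card_le_card hsub).trans hcard
  rw [Finset.card_eq_three.2 ⟨1, u', v', ?_, ?_, ?_, rfl⟩] at this
  · lia
  · simpa [Subtype.ext_iff, u'] using hu1.symm
  · simpa [Subtype.ext_iff, v'] using hv1.symm
  · simpa [Subtype.ext_iff, u', v'] using huv

theorem List.exists_shift_of_map_isRotated_map {X : Type*} {L : List X} [NeZero L.length]
    {σ τ : Equiv.Perm X} (h : L.map σ ~r L.map τ) :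
    ∃ p : ZMod L.length, ∀ x : ZMod L.length,
      L[(x + p).val]'(ZMod.val_lt _) = (σ⁻¹ * τ) (L[x.val]'(ZMod.val_lt _)) := by
  obtain ⟨r, hr⟩ := h
  refine ⟨r, fun x => ?_⟩
  have hx := List.getElem_of_eq hr (i := x.val) (by simpa using ZMod.val_lt x)
  simp only [getElem_rotate, getElem_map, length_map] at hx
  rw [Equiv.Perm.mul_apply, Equiv.Perm.eq_inv_iff_eq, ← hx]
  congr 2
  rw [ZMod.val_add, ZMod.val_natCast, Nat.add_mod_mod]

/-- The key claim in the proof of Lemma 3.2 (OrbitsConjugacy): if `g` is a cyclically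
reduced word of length `≥ 1` in which every factor subgroup is represented, then for any
three pairwise disjoint transpositions `σ, τ, δ`, the images `Φ σ g, Φ τ g, Φ δ g` are not
all pairwise conjugate. -/
theorem three_disjoint_transpositions_not_all_conj {A H : Type*} [Group A] [Group H]
    (φ : A →* H) (hφ : Function.Injective φ) (n : ℕ)
    (Φ : Equiv.Perm (Fin n) →
      (Monoid.PushoutI (fun _ : Fin n => φ) →* Monoid.PushoutI (fun _ : Fin n => φ)))
    (hΦ : ∀ (σ : Equiv.Perm (Fin n)) (i : Fin n),
      (Φ σ).comp (Monoid.PushoutI.of (φ := fun _ : Fin n => φ) i) =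
        Monoid.PushoutI.of (φ := fun _ : Fin n => φ) (σ i))
    (g : Monoid.PushoutI (fun _ : Fin n => φ)) (w : A) (l : List (Fin n × H))
    (hlen : 1 ≤ l.length)
    (hred : IsCyclicallyReducedDatum φ g w l)
    (hrep : ∀ i : Fin n, ∃ p ∈ l, p.1 = i)
    (a b c d e f : Fin n)
    (hab : a ≠ b) (hcd : c ≠ d) (hef : e ≠ f)
    (hac : a ≠ c) (had : a ≠ d) (hae : a ≠ e) (haf : a ≠ f)
    (hbc : b ≠ c) (hbd : b ≠ d) (hbe : b ≠ e) (hbf : b ≠ f)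
    (hce : c ≠ e) (hcf : c ≠ f) (hde : d ≠ e) (hdf : d ≠ f) :
    ¬ (IsConj (Φ (Equiv.swap a b) g) (Φ (Equiv.swap c d) g) ∧
       IsConj (Φ (Equiv.swap a b) g) (Φ (Equiv.swap e f) g)) := by
  rintro ⟨hτ, hδ⟩
  have : Nonempty (Fin n) := ⟨a⟩
  set L := l.map Prod.fst with hL
  have hgL : Monoid.PushoutI.HasSyllables (fun _ : Fin n => φ) g L := hred.1.hasSyllables
  have hmem (i : Fin n) : i ∈ L := by simpa [hL] using hrep i
  have : NeZero L.length := ⟨by simp only [hL, List.length_map]; lia⟩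
  have hlen' : 1 < l.length := by
    by_contra hl
    obtain ⟨p, hp⟩ := List.length_eq_one_iff.1 (by lia : l.length = 1)
    have ha := hmem a
    have hb := hmem b
    simp only [hL, hp, List.map_cons, List.map_nil, List.mem_singleton] at ha hb
    exact hab (ha.trans hb.symm)
  have hcyc (σ : Equiv.Perm (Fin n)) : ∀ i ∈ (L.map σ).getLast?, i ∉ (L.map σ).head? := by
    intro i hi hi'
    simp only [hL, List.getLast?_map, List.head?_map, Option.mem_def, Option.map_map,
      Option.map_eq_some_iff] at hi hi'
    obtain ⟨q, hq, rfl⟩ := hi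
    obtain ⟨p, hp, hpq⟩ := hi'
    exact hred.2 hlen' p hp q hq (σ.injective hpq)
  have hrot {σ τ : Equiv.Perm (Fin n)} (h : IsConj (Φ σ g) (Φ τ g)) : L.map σ ~r L.map τ :=
    (hgL.map_of_permutes (hΦ σ)).isRotated_of_isConj (fun _ => hφ) (hgL.map_of_permutes (hΦ τ))
      (hcyc σ) (hcyc τ) h
  obtain ⟨p, hp⟩ := List.exists_shift_of_map_isRotated_map (hrot hτ)
  obtain ⟨q, hq⟩ := List.exists_shift_of_map_isRotated_map (hrot hδ)
  have hsurj : Function.Surjective fun x : ZMod L.length => L[x.val]'(ZMod.val_lt _) := by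
    intro i
    obtain ⟨k, hk, rfl⟩ := List.mem_iff_getElem.1 (hmem i)
    exact ⟨k, by simp [ZMod.val_natCast, Nat.mod_eq_of_lt hk]⟩
  have hτa : ((Equiv.swap a b)⁻¹ * Equiv.swap c d) a = b := by
    simp [Equiv.swap_apply_of_ne_of_ne, hac, had]
  have hδa : ((Equiv.swap a b)⁻¹ * Equiv.swap e f) a = b := by
    simp [Equiv.swap_apply_of_ne_of_ne, hae, haf]
  have hsq {x y : Fin n} (hax : a ≠ x) (hay : a ≠ y) (hbx : b ≠ x) (hby : b ≠ y)
      (hxy : x ≠ y) : ((Equiv.swap a b)⁻¹ * Equiv.swap x y) ^ 2 = 1 := by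
    have hcomm := (Equiv.Perm.disjoint_swap_swap (x := a) (y := b) (z := x) (t := y)
      (by simp [*])).commute
    rw [Equiv.swap_inv, hcomm.mul_pow, pow_two, pow_two, Equiv.swap_mul_self, Equiv.swap_mul_self,
      mul_one]
  have huv := Equiv.Perm.eq_of_cyclic_shift hsurj hp hq (hsq hac had hbc hbd hcd)
    (hsq hae haf hbe hbf hef) (fun h => hab (by rwa [h] at hτa))
    (fun h => hab (by rwa [h] at hδa))
  have hc := DFunLike.congr_fun (mul_left_cancel huv) c
  rw [Equiv.swap_apply_left, Equiv.swap_apply_of_ne_of_ne hce hcf] at hc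
  exact hcd hc.symm
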